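/- Let γ be a smooth closed unit-speed curve in ℝ³ with curvature κ. The Brylinski beta function B(s) = ∫∫ ‖γ(x) − γ(y)‖^s dx dy has residue at s = −3 equal to (1/4) ∫ κ(x)² dx. Equivalently, in the local model where the curve is the graph (u, a₂u² + O(u³), b₂u² + O(u³)) near a point v, the residue at s = −3 of the slice integral ∫ ‖γ(x) − v‖^s dx equals a₂² + b₂², and κ(v)²/4 = a₂² + b₂². -/

import Mathlib

open MeasureTheory Filter

open scoped ContDiff Topology Interval in
theorem bry_hasFDerivAt_param {E F : Type} [NormedAddCommGroup E] [NormedSpace ℝ E] [ProperSpace E]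
    [NormedAddCommGroup F] [NormedSpace ℝ F] (a b : ℝ)
    (f : E × ℝ → F) (hf : ContDiff ℝ ∞ f) (p : E) :
    HasFDerivAt (fun p => ∫ t in a..b, f (p, t))
      (∫ t in a..b, (fderiv ℝ f (p, t)).comp (ContinuousLinearMap.inl ℝ E ℝ)) p := by
  have hcf : Continuous f := hf.continuous
  have hcd : Continuous (fderiv ℝ f) := hf.continuous_fderiv (by simp)
  have hc' : Continuous (fun q : E × ℝ => (fderiv ℝ f q).comp (ContinuousLinearMap.inl ℝ E ℝ)) :=
    hcd.clm_comp continuous_const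
  have hK : IsCompact (Metric.closedBall p 1 ×ˢ [[a, b]]) :=
    (isCompact_closedBall p 1).prod isCompact_uIcc
  obtain ⟨C, hC⟩ := hK.exists_bound_of_continuousOn hc'.continuousOn
  refine intervalIntegral.hasFDerivAt_integral_of_dominated_of_fderiv_le
    (F := fun p t => f (p, t))
    (F' := fun p t => (fderiv ℝ f (p, t)).comp (ContinuousLinearMap.inl ℝ E ℝ))
    (bound := fun _ => C) (Metric.closedBall_mem_nhds p one_pos) ?_ ?_ ?_ ?_ ?_ ?_
  · exact Eventually.of_forall fun x =>
      (hcf.comp (by fun_prop : Continuous fun t : ℝ => (x, t))).aestronglyMeasurable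
  · exact (hcf.comp (by fun_prop : Continuous fun t : ℝ => (p, t))).intervalIntegrable _ _
  · exact (hc'.comp (by fun_prop : Continuous fun t : ℝ => (p, t))).aestronglyMeasurable
  · exact Eventually.of_forall fun t ht x hx => hC (x, t) ⟨hx, Set.uIoc_subset_uIcc ht⟩
  · exact intervalIntegrable_const
  · refine Eventually.of_forall fun t ht x hx => ?_
    have h1 : HasFDerivAt f (fderiv ℝ f (x, t)) (x, t) :=
      (hf.differentiable (by simp) (x, t)).hasFDerivAt
    exact h1.comp x (hasFDerivAt_prodMk_left x t)

open scoped ContDiff Topology Interval in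
theorem bry_contDiff_param_nat {E : Type} [NormedAddCommGroup E] [NormedSpace ℝ E] [ProperSpace E]
    (a b : ℝ) (n : ℕ) : ∀ {F : Type} [NormedAddCommGroup F] [NormedSpace ℝ F]
    (f : E × ℝ → F) (_ : ContDiff ℝ ∞ f),
    ContDiff ℝ n (fun p => ∫ t in a..b, f (p, t)) := by
  induction n with
  | zero =>
    intro F _ _ f hf
    refine contDiff_zero.2 ?_
    exact intervalIntegral.continuous_parametric_intervalIntegral_of_continuous'
      (f := fun p t => f (p, t)) (by simpa [Function.uncurry_def] using hf.continuous) a b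
  | succ n ih =>
    intro F _ _ f hf
    have := (contDiff_succ_iff_hasFDerivAt (𝕜 := ℝ) (n := n)
      (f := fun p => ∫ t in a..b, f (p, t))).2
      ⟨fun p => ∫ t in a..b, (fderiv ℝ f (p, t)).comp (ContinuousLinearMap.inl ℝ E ℝ), ?_,
        fun p => bry_hasFDerivAt_param a b f hf p⟩
    · exact_mod_cast this
    · exact ih (fun q => (fderiv ℝ f q).comp (ContinuousLinearMap.inl ℝ E ℝ))
        ((hf.fderiv_right (by simp)).clm_comp contDiff_const)

open scoped ContDiff Topology Interval in
theorem bry_contDiff_param {E F : Type} [NormedAddCommGroup E] [NormedSpace ℝ E] [ProperSpace E]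
    [NormedAddCommGroup F] [NormedSpace ℝ F]
    (a b : ℝ) (f : E × ℝ → F) (hf : ContDiff ℝ ∞ f) :
    ContDiff ℝ ∞ (fun p => ∫ t in a..b, f (p, t)) :=
  contDiff_infty.2 fun n => bry_contDiff_param_nat a b n f hf

/-- Hadamard lemma with parameters. -/
theorem bry_hadamard {E F : Type} [NormedAddCommGroup E] [NormedSpace ℝ E] [ProperSpace E]
    [NormedAddCommGroup F] [NormedSpace ℝ F] [CompleteSpace F]
    (f : E × ℝ → F) (hf : ContDiff ℝ (⊤ : ℕ∞) f) :
    ∃ k : E × ℝ → F, ContDiff ℝ (⊤ : ℕ∞) k ∧ ∀ p t, f (p, t) = f (p, 0) + t • k (p, t) := by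
  refine ⟨fun q => ∫ u in (0:ℝ)..1, fderiv ℝ f (q.1, u * q.2) (0, 1), ?_, ?_⟩
  · refine bry_contDiff_param 0 1
      (fun r : (E × ℝ) × ℝ => fderiv ℝ f (r.1.1, r.2 * r.1.2) (0, 1)) ?_
    have h1 : ContDiff ℝ (⊤ : ℕ∞) (fderiv ℝ f) := hf.fderiv_right (by simp)
    exact (h1.comp (by fun_prop)).clm_apply contDiff_const
  · intro p t
    have hd : ∀ u : ℝ, HasDerivAt (fun u : ℝ => f (p, u * t))
        (t • fderiv ℝ f (p, u * t) (0, 1)) u := by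
      intro u
      have h1 : HasFDerivAt f (fderiv ℝ f (p, u * t)) (p, u * t) :=
        (hf.differentiable (by simp) _).hasFDerivAt
      have h2 : HasDerivAt (fun u : ℝ => (p, u * t)) ((0 : E), t) u := by
        have := (hasDerivAt_const u p).prodMk ((hasDerivAt_id u).mul_const t)
        simpa using this
      have h3 := h1.comp_hasDerivAt u h2
      have h4 : ((0 : E), t) = t • ((0 : E), (1 : ℝ)) := by simp
      rw [h4, map_smul] at h3
      exact h3
    have hcd : Continuous (fderiv ℝ f) := hf.continuous_fderiv (by simp)
    have hc : Continuous fun u : ℝ => t • fderiv ℝ f (p, u * t) (0, 1) :=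
      ((hcd.comp (by fun_prop)).clm_apply continuous_const).const_smul t
    have := intervalIntegral.integral_eq_sub_of_hasDerivAt (a := 0) (b := 1)
      (fun u _ => hd u) (hc.intervalIntegrable _ _)
    rw [intervalIntegral.integral_smul] at this
    simp only [one_mul, zero_mul] at this
    rw [this]; abel

/-- Holomorphy of parametric integrals. -/
theorem bry_holo_integral {α : Type} [MeasurableSpace α] (μ : Measure α) (f : ℂ → α → ℂ) (s₀ : ℂ)
    (r : ℝ) (hr : 0 < r) (bound : α → ℝ)
    (hmeas : ∀ s, AEStronglyMeasurable (f s) μ)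
    (hdiff : ∀ᵐ t ∂μ, Differentiable ℂ (fun s => f s t))
    (hb : ∀ᵐ t ∂μ, ∀ s ∈ Metric.closedBall s₀ (2 * r), ‖f s t‖ ≤ bound t)
    (hbi : Integrable bound μ) :
    DifferentiableAt ℂ (fun s => ∫ t, f s t ∂μ) s₀ := by
  have := hasDerivAt_integral_of_dominated_loc_of_deriv_le (μ := μ) (F := f)
    (F' := fun s t => deriv (fun s => f s t) s) (x₀ := s₀) (s := Metric.closedBall s₀ r)
    (bound := fun t => bound t / r)
    (Metric.closedBall_mem_nhds s₀ hr) (Eventually.of_forall hmeas) ?_ ?_ ?_ (hbi.div_const r) ?_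
  · exact this.2.differentiableAt
  · refine hbi.mono' (hmeas s₀) ?_
    filter_upwards [hb] with t ht
    exact ht s₀ (Metric.mem_closedBall_self (by positivity))
  · refine aestronglyMeasurable_of_tendsto_ae (u := (atTop : Filter ℕ))
      (f := fun (n : ℕ) t => ((n : ℂ) + 1) * (f (s₀ + 1 / ((n : ℂ) + 1)) t - f s₀ t)) ?_ ?_
    · intro n
      exact (((hmeas _).sub (hmeas _))).const_mul _
    · filter_upwards [hdiff] with t ht
      have h1 := (ht s₀).hasDerivAt.tendsto_slope_zero
      have h2 : Tendsto (fun n : ℕ => 1 / ((n : ℂ) + 1)) atTop (nhdsWithin 0 {0}ᶜ) := by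
        refine tendsto_nhdsWithin_iff.2 ⟨tendsto_one_div_add_atTop_nhds_zero_nat,
          Eventually.of_forall fun n => ?_⟩
        have : (n : ℂ) + 1 ≠ 0 := Nat.cast_add_one_ne_zero n
        simp [this]
      refine (h1.comp h2).congr fun n => ?_
      simp
  · filter_upwards [hdiff, hb] with t ht hbt s hs
    refine Complex.norm_deriv_le_of_forall_mem_sphere_norm_le hr ht.diffContOnCl ?_
    intro z hz
    refine hbt z ?_
    rw [Metric.mem_closedBall] at *
    rw [Metric.mem_sphere] at hz
    linarith [dist_triangle z s s₀]
  · filter_upwards [hdiff] with t ht s hs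
    exact (ht s).hasDerivAt


/-- Smooth in `(s,t)`, entire in `s`, even in `t`. -/
structure BryClass (h : ℂ × ℝ → ℂ) : Prop where
  smooth : ContDiff ℝ (⊤ : ℕ∞) h
  holo : ∀ t, Differentiable ℂ (fun s => h (s, t))
  even : ∀ s t, h (s, -t) = h (s, t)

theorem bry_hadamard_holo (h : ℂ × ℝ → ℂ) (hh : ContDiff ℝ (⊤ : ℕ∞) h)
    (hol : ∀ t, Differentiable ℂ (fun s => h (s, t))) :
    ∃ k : ℂ × ℝ → ℂ, ContDiff ℝ (⊤ : ℕ∞) k ∧ (∀ t, Differentiable ℂ (fun s => k (s, t))) ∧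
      ∀ p t, h (p, t) = h (p, 0) + t • k (p, t) := by
  obtain ⟨k, hk, hkt⟩ := bry_hadamard h hh
  refine ⟨k, hk, ?_, hkt⟩
  have hne : ∀ t : ℝ, t ≠ 0 → Differentiable ℂ (fun s => k (s, t)) := by
    intro t ht
    have : (fun s => k (s, t)) = fun s => (t : ℂ)⁻¹ * (h (s, t) - h (s, 0)) := by
      funext s
      rw [hkt s t]
      have : (t : ℂ) ≠ 0 := by exact_mod_cast ht
      simp [this]
    rw [this]
    exact (((hol t).sub (hol 0))).const_mul _
  have hR : ∀ s t, HasFDerivAt (fun s => k (s, t))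
      ((fderiv ℝ k (s, t)).comp (ContinuousLinearMap.inl ℝ ℂ ℝ)) s := by
    intro s t
    have h1 : HasFDerivAt k (fderiv ℝ k (s, t)) (s, t) :=
      (hk.differentiable (by simp) (s, t)).hasFDerivAt
    exact h1.comp s (hasFDerivAt_prodMk_left s t)
  have hcd : Continuous (fderiv ℝ k) := hk.continuous_fderiv (by simp)
  intro t s
  rw [differentiableAt_complex_iff_differentiableAt_real]
  refine ⟨(hR s t).differentiableAt, ?_⟩
  rw [(hR s t).fderiv]
  have key : (fun t : ℝ => fderiv ℝ k (s, t) (Complex.I, 0)) =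
      fun t : ℝ => Complex.I • fderiv ℝ k (s, t) (1, 0) := by
    refine Continuous.ext_on (s := {(0:ℝ)}ᶜ) (dense_compl_singleton 0) ?_ ?_ ?_
    · exact (hcd.comp (by fun_prop)).clm_apply continuous_const
    · have h2 : Continuous fun t : ℝ => fderiv ℝ k (s, t) (1, 0) :=
        (hcd.comp (by fun_prop)).clm_apply continuous_const
      exact Continuous.const_smul h2 Complex.I
    · intro t ht
      have := (differentiableAt_complex_iff_differentiableAt_real.1 (hne t ht s)).2
      rw [(hR s t).fderiv] at this
      simpa using this
  simpa using congrFun key t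

theorem BryClass.step {h : ℂ × ℝ → ℂ} (hh : BryClass h) :
    ∃ k, BryClass k ∧ ∀ s t, h (s, t) = h (s, 0) + (t : ℂ) ^ 2 * k (s, t) := by
  obtain ⟨k₁, hk₁, hol₁, e₁⟩ := bry_hadamard_holo h hh.smooth hh.holo
  obtain ⟨k₂, hk₂, hol₂, e₂⟩ := bry_hadamard_holo k₁ hk₁ hol₁
  have odd : ∀ s t, k₁ (s, -t) + k₁ (s, t) = 0 := by
    intro s t
    have hc := hk₁.continuous
    have : (fun t : ℝ => k₁ (s, -t) + k₁ (s, t)) = fun _ => 0 := by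
      refine Continuous.ext_on (s := {(0:ℝ)}ᶜ) (dense_compl_singleton 0) (by fun_prop)
        (by fun_prop) ?_
      intro t ht
      have ht' : (t : ℂ) ≠ 0 := by exact_mod_cast ht
      have h1 := hh.even s t
      rw [e₁ s t, e₁ s (-t)] at h1
      simp only [Complex.real_smul, Complex.ofReal_neg, neg_mul, add_right_inj] at h1
      refine (mul_eq_zero.1 (?_ : (t : ℂ) * _ = 0)).resolve_left ht'
      simp only
      linear_combination -h1
    exact congrFun this t
  have zero : ∀ s, k₁ (s, 0) = 0 := by
    intro s
    have := odd s 0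
    rw [neg_zero] at this
    linear_combination this / 2
  refine ⟨k₂, ⟨hk₂, hol₂, ?_⟩, ?_⟩
  · intro s t
    by_cases ht : t = 0
    · simp [ht]
    have ht' : (t : ℂ) ≠ 0 := by exact_mod_cast ht
    have h1 := odd s t
    rw [e₂ s t, e₂ s (-t), zero] at h1
    simp only [Complex.real_smul, Complex.ofReal_neg, neg_mul, zero_add] at h1
    refine mul_left_cancel₀ ht' ?_
    linear_combination -h1
  · intro s t
    rw [e₁ s t, e₂ s t, zero]
    simp only [Complex.real_smul]
    ring

theorem bry_rpow_le {t x σ τ : ℝ} (ht : 0 < t) (h1 : σ ≤ x) (h2 : x ≤ τ) :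
    t ^ x ≤ t ^ σ + t ^ τ := by
  rcases le_total t 1 with h | h
  · have := Real.rpow_le_rpow_of_exponent_ge ht h h1
    have := Real.rpow_nonneg ht.le τ
    linarith
  · have := Real.rpow_le_rpow_of_exponent_le h h2
    have := Real.rpow_nonneg ht.le σ
    linarith

theorem bry_J_diff {h : ℂ × ℝ → ℂ} (hh : BryClass h) (a : ℝ) (ha : 0 < a) (N : ℕ) (s₀ : ℂ)
    (hs₀ : -1 - 2 * (N : ℝ) < s₀.re) :
    DifferentiableAt ℂ (fun s : ℂ => ∫ t in (0:ℝ)..a, (t : ℂ) ^ (s + 2 * (N : ℂ)) * h (s, t)) s₀ := by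
  simp only [intervalIntegral.integral_of_le ha.le]
  have hc := hh.smooth.continuous
  set r : ℝ := (s₀.re + 1 + 2 * N) / 4 with hr
  have hrpos : 0 < r := by rw [hr]; linarith
  obtain ⟨C, hC⟩ := ((isCompact_closedBall s₀ (2 * r)).prod
    (isCompact_Icc (a := (0:ℝ)) (b := a))).exists_bound_of_continuousOn hc.continuousOn
  set σ : ℝ := s₀.re + 2 * N - 2 * r with hσ
  set τ : ℝ := s₀.re + 2 * N + 2 * r with hτ
  have hσ1 : -1 < σ := by rw [hσ, hr]; linarith
  have hτ1 : -1 < τ := by linarith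
  refine bry_holo_integral (volume.restrict (Set.Ioc 0 a))
    (fun s t => (t : ℂ) ^ (s + 2 * (N : ℂ)) * h (s, t)) s₀ r hrpos
    (fun t => (t ^ σ + t ^ τ) * C) ?_ ?_ ?_ ?_
  · intro s
    refine ContinuousOn.aestronglyMeasurable ?_ measurableSet_Ioc
    refine ContinuousOn.mul ?_ (by fun_prop)
    intro t ht
    refine ContinuousAt.continuousWithinAt ?_
    exact (Complex.continuousAt_ofReal_cpow_const t _ (Or.inr ht.1.ne'))
  · filter_upwards [ae_restrict_mem measurableSet_Ioc] with t ht
    refine Differentiable.mul ?_ (hh.holo t)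
    have : (t : ℂ) ≠ 0 := by exact_mod_cast ht.1.ne'
    intro s
    exact DifferentiableAt.const_cpow (by fun_prop) (Or.inl this)
  · filter_upwards [ae_restrict_mem measurableSet_Ioc] with t ht s hs
    rw [norm_mul, Complex.norm_cpow_eq_rpow_re_of_pos ht.1]
    have h1 : |s.re - s₀.re| ≤ 2 * r := by
      have := Complex.abs_re_le_norm (s - s₀)
      rw [Complex.sub_re] at this
      rw [Metric.mem_closedBall, dist_eq_norm] at hs
      exact this.trans hs
    have h2 : (s + 2 * (N : ℂ)).re = s.re + 2 * N := by simp
    rw [h2]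
    have h3 := abs_le.1 h1
    refine mul_le_mul (bry_rpow_le ht.1 ?_ ?_) (hC (s, t) ⟨hs, ht.1.le, ht.2⟩) (norm_nonneg _) ?_
    · rw [hσ]; linarith
    · rw [hτ]; linarith
    · have := ht.1.le; positivity
  · have := ((intervalIntegral.intervalIntegrable_rpow' (a := 0) (b := a) hσ1).add
      (intervalIntegral.intervalIntegrable_rpow' (a := 0) (b := a) hτ1)).mul_const C
    exact (intervalIntegrable_iff_integrableOn_Ioc_of_le ha.le).1 this

theorem bry_cpow_mul_integrable (a : ℝ) (s : ℂ) (hs : -1 < s.re) (f : ℝ → ℂ) (hf : Continuous f) :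
    IntervalIntegrable (fun t : ℝ => (t : ℂ) ^ s * f t) volume 0 a :=
  (intervalIntegral.intervalIntegrable_cpow' hs).mul_continuousOn hf.continuousOn

theorem bry_J_step {h k : ℂ × ℝ → ℂ} (hk : BryClass k)
    (e : ∀ s t, h (s, t) = h (s, 0) + (t : ℂ) ^ 2 * k (s, t))
    (a : ℝ) (ha : 0 < a) (N : ℕ) (s : ℂ) (hs : -1 - 2 * (N : ℝ) < s.re) :
    ∫ t in (0:ℝ)..a, (t : ℂ) ^ (s + 2 * (N : ℂ)) * h (s, t) =
      h (s, 0) * (a : ℂ) ^ (s + 2 * (N : ℂ) + 1) / (s + 2 * (N : ℂ) + 1) +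
      ∫ t in (0:ℝ)..a, (t : ℂ) ^ (s + 2 * ((N + 1 : ℕ) : ℂ)) * k (s, t) := by
  have hre : -1 < (s + 2 * (N : ℂ)).re := by simp; linarith
  have hne : s + 2 * (N : ℂ) + 1 ≠ 0 := by
    intro h0
    have := congrArg Complex.re h0
    simp at this hre
    linarith
  have hkc := hk.smooth.continuous
  have h1 : ∫ t in (0:ℝ)..a, (t : ℂ) ^ (s + 2 * (N : ℂ)) * h (s, t) =
      ∫ t in (0:ℝ)..a, ((t : ℂ) ^ (s + 2 * (N : ℂ)) * h (s, 0) +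
        (t : ℂ) ^ (s + 2 * (N : ℂ)) * ((t : ℂ) ^ 2 * k (s, t))) := by
    refine intervalIntegral.integral_congr fun t _ => ?_
    rw [e s t]; ring
  rw [h1, intervalIntegral.integral_add
    (bry_cpow_mul_integrable a _ hre _ continuous_const)
    (bry_cpow_mul_integrable a _ hre _ (by fun_prop)), intervalIntegral.integral_mul_const,
    integral_cpow (Or.inl hre)]
  congr 1
  · rw [Complex.ofReal_zero, Complex.zero_cpow hne]; ring
  · rw [intervalIntegral.integral_of_le ha.le, intervalIntegral.integral_of_le ha.le]
    refine setIntegral_congr_fun measurableSet_Ioc fun t ht => ?_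
    have ht0 : (t : ℂ) ≠ 0 := by exact_mod_cast ht.1.ne'
    rw [← mul_assoc, ← Complex.cpow_ofNat (t : ℂ) 2, ← Complex.cpow_add _ _ ht0]
    congr 2
    push_cast; ring

theorem bry_continuation {h : ℂ × ℝ → ℂ} (hh : BryClass h) (a : ℝ) (ha : 0 < a) :
    ∃ F : ℂ → ℂ, (∀ s : ℂ, -1 < s.re → F s = ∫ t in (0:ℝ)..a, (t : ℂ) ^ s * h (s, t)) ∧
      (∀ s : ℂ, (∀ j : ℕ, s ≠ -1 - 2 * j) → AnalyticAt ℂ F s) ∧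
      ∃ k, BryClass k ∧ (∀ s t, h (s, t) = h (s, 0) + (t : ℂ) ^ 2 * k (s, t)) ∧
        ∃ G : ℂ → ℂ, AnalyticAt ℂ G (-3) ∧ ∀ᶠ s in nhdsWithin (-3 : ℂ) {(-3 : ℂ)}ᶜ,
          F s = k (-3, 0) / (s + 3) + G s := by
  choose! nxt hn1 hn2 using fun (h : ℂ × ℝ → ℂ) (hh : BryClass h) => hh.step
  let H : ℕ → ℂ × ℝ → ℂ := fun n => nxt^[n] h
  have H0 : H 0 = h := rfl
  have Hs : ∀ n, H (n + 1) = nxt (H n) := fun n => Function.iterate_succ_apply' nxt n h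
  have Hc : ∀ n, BryClass (H n) := by
    intro n
    induction n with
    | zero => exact hh
    | succ n ih => rw [Hs]; exact hn1 _ ih
  have He : ∀ n s t, H n (s, t) = H n (s, 0) + (t : ℂ) ^ 2 * H (n + 1) (s, t) := by
    intro n s t
    rw [Hs]; exact hn2 _ (Hc n) s t
  let P : ℕ → ℂ → ℂ := fun j s =>
    H j (s, 0) * (a : ℂ) ^ (s + 2 * (j : ℂ) + 1) / (s + 2 * (j : ℂ) + 1)
  let J : ℕ → ℂ → ℂ := fun N s => ∫ t in (0:ℝ)..a, (t : ℂ) ^ (s + 2 * (N : ℂ)) * H N (s, t)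
  let FN : ℕ → ℂ → ℂ := fun N s => (∑ j ∈ Finset.range N, P j s) + J N s
  have stepN : ∀ (N : ℕ) (s : ℂ), -1 - 2 * (N : ℝ) < s.re → FN (N + 1) s = FN N s := by
    intro N s hs
    have : J N s = P N s + J (N + 1) s := bry_J_step (Hc (N + 1)) (He N) a ha N s hs
    simp only [FN, Finset.sum_range_succ, this]
    ring
  have stepM : ∀ (N M : ℕ) (s : ℂ), N ≤ M → -1 - 2 * (N : ℝ) < s.re → FN M s = FN N s := by
    intro N M s hNM hs
    induction M, hNM using Nat.le_induction with
    | base => rfl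
    | succ M hM ih =>
      rw [stepN M s _, ih]
      have : (N : ℝ) ≤ M := by exact_mod_cast hM
      linarith
  let F : ℂ → ℂ := fun s => FN ⌈|s.re|⌉₊ s
  have FeqN : ∀ (N : ℕ) (s : ℂ), -1 - 2 * (N : ℝ) < s.re → F s = FN N s := by
    intro N s hs
    have h1 : -1 - 2 * ((⌈|s.re|⌉₊ : ℕ) : ℝ) < s.re := by
      have := Nat.le_ceil |s.re|
      have := neg_abs_le s.re
      have := abs_nonneg s.re
      linarith
    rcases le_total N ⌈|s.re|⌉₊ with h | h
    · exact stepM _ _ s h hs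
    · exact (stepM _ _ s h h1).symm
  have opn : ∀ N : ℕ, IsOpen {s : ℂ | -1 - 2 * (N : ℝ) < s.re} := fun N =>
    isOpen_lt continuous_const Complex.continuous_re
  have ha0 : (a : ℂ) ≠ 0 := by exact_mod_cast ha.ne'
  have numDiff : ∀ j : ℕ, Differentiable ℂ
      (fun s : ℂ => H j (s, 0) * (a : ℂ) ^ (s + 2 * (j : ℂ) + 1)) := by
    intro j
    refine Differentiable.mul ((Hc j).holo 0) fun s => ?_
    exact DifferentiableAt.const_cpow (by fun_prop) (Or.inl ha0)
  have JAn : ∀ (N : ℕ) (s : ℂ), -1 - 2 * (N : ℝ) < s.re → AnalyticAt ℂ (J N) s := by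
    intro N s hs
    refine DifferentiableOn.analyticAt (s := {s : ℂ | -1 - 2 * (N : ℝ) < s.re}) ?_
      ((opn N).mem_nhds hs)
    intro z hz
    exact (bry_J_diff (Hc N) a ha N z hz).differentiableWithinAt
  have PAn : ∀ (j : ℕ) (s : ℂ), s ≠ -1 - 2 * j → AnalyticAt ℂ (P j) s := by
    intro j s hs
    refine AnalyticAt.div ((numDiff j).analyticAt s) (by fun_prop) ?_
    intro h0
    apply hs
    linear_combination h0
  refine ⟨F, ?_, ?_, H 1, Hc 1, He 0, ?_⟩
  · intro s hs
    rw [FeqN 0 s (by simpa using hs)]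
    simp [FN, J, H0]
  · intro s hs
    obtain ⟨N, hN⟩ := exists_nat_gt |s.re|
    have h1 : -1 - 2 * (N : ℝ) < s.re := by
      have := neg_abs_le s.re
      have := abs_nonneg s.re
      linarith
    have : AnalyticAt ℂ (FN N) s := by
      refine AnalyticAt.add ?_ (JAn N s h1)
      exact Finset.analyticAt_fun_sum _ fun j _ => PAn j s (hs j)
    refine this.congr ?_
    filter_upwards [(opn N).mem_nhds h1] with z hz
    exact (FeqN N z hz).symm
  · set A : ℂ → ℂ := fun s => H 1 (s, 0) * (a : ℂ) ^ (s + 2 * ((1 : ℕ) : ℂ) + 1) with hA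
    refine ⟨fun s => P 0 s + dslope A (-3) s + J 2 s, ?_, ?_⟩
    · refine ((PAn 0 (-3) (by norm_num)).add ?_).add (JAn 2 _ (by norm_num))
      refine DifferentiableOn.analyticAt (s := Set.univ) ?_ univ_mem
      rw [Complex.differentiableOn_dslope univ_mem]
      exact (numDiff 1).differentiableOn
    · have h1 : ∀ᶠ s in nhdsWithin (-3 : ℂ) {(-3 : ℂ)}ᶜ, -1 - 2 * ((2 : ℕ) : ℝ) < s.re :=
        nhdsWithin_le_nhds ((opn 2).mem_nhds (by norm_num))
      filter_upwards [h1, self_mem_nhdsWithin] with s hs hs3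
      have hs3' : s ≠ -3 := hs3
      have hne : s + 3 ≠ 0 := fun h0 => hs3' (by linear_combination h0)
      rw [FeqN 2 s hs]
      have hP1 : P 1 s = A s / (s + 3) := by
        simp only [P, hA]
        congr 1
        push_cast; ring
      have hA3 : A (-3) = H 1 (-3, 0) := by
        have : (-3 : ℂ) + 2 * ((1 : ℕ) : ℂ) + 1 = 0 := by push_cast; ring
        simp only [hA, this, Complex.cpow_zero, mul_one]
      simp only [FN, Finset.sum_range_succ, Finset.sum_range_zero, zero_add, hP1]
      rw [dslope_of_ne _ hs3', slope_def_field, hA3]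
      have : s - -3 = s + 3 := by ring
      rw [this]
      ring


theorem bry_div (P p : ℝ → ℝ) (hP : ∀ t, HasDerivAt P (p t) t) (h0 : P 0 = 0) (n : ℕ) (c : ℝ)
    (h : Tendsto (fun t => p t / t ^ n) (nhdsWithin 0 {0}ᶜ) (nhds c)) :
    Tendsto (fun t => P t / t ^ (n + 1)) (nhdsWithin 0 {0}ᶜ) (nhds (c / (n + 1))) := by
  have hn : ((n : ℝ) + 1) ≠ 0 := Nat.cast_add_one_ne_zero n
  refine HasDerivAt.lhopital_zero_nhdsNE (f' := p) (g' := fun t => ((n : ℝ) + 1) * t ^ n)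
    (Eventually.of_forall hP) (Eventually.of_forall fun t => ?_) ?_ ?_ ?_ ?_
  · simpa using hasDerivAt_pow (n + 1) t
  · filter_upwards [self_mem_nhdsWithin] with t ht
    exact mul_ne_zero hn (pow_ne_zero _ ht)
  · have := (hP 0).continuousAt.tendsto
    rw [h0] at this
    exact this.mono_left nhdsWithin_le_nhds
  · have : Tendsto (fun t : ℝ => t ^ (n + 1)) (nhds 0) (nhds 0) := by
      have := (continuous_pow (M := ℝ) (n + 1)).tendsto 0
      simpa using this
    exact this.mono_left nhdsWithin_le_nhds
  · refine (h.div_const ((n : ℝ) + 1)).congr fun t => ?_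
    rw [div_div, mul_comm]

theorem bry_local {V : Type} [NormedAddCommGroup V] [InnerProductSpace ℝ V] (γ : ℝ → V)
    (hγ : ContDiff ℝ (⊤ : ℕ∞) γ) (hspeed : ∀ x, ‖deriv γ x‖ = 1) (x : ℝ) :
    Tendsto (fun t => (‖γ (x + t) - γ x‖ ^ 2 - t ^ 2) / t ^ 4) (nhdsWithin 0 {0}ᶜ)
      (nhds (-‖deriv (deriv γ) x‖ ^ 2 / 12)) := by
  have c1 : ContDiff ℝ (⊤ : ℕ∞) (deriv γ) := (contDiff_infty_iff_deriv.1 hγ).2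
  have c2 : ContDiff ℝ (⊤ : ℕ∞) (deriv (deriv γ)) := (contDiff_infty_iff_deriv.1 c1).2
  have d0 : ∀ y, HasDerivAt γ (deriv γ y) y := fun y =>
    (hγ.differentiable (by simp) y).hasDerivAt
  have d1 : ∀ y, HasDerivAt (deriv γ) (deriv (deriv γ) y) y := fun y =>
    (c1.differentiable (by simp) y).hasDerivAt
  have d2 : ∀ y, HasDerivAt (deriv (deriv γ)) (deriv (deriv (deriv γ)) y) y := fun y =>
    (c2.differentiable (by simp) y).hasDerivAt
  set γ1 := deriv γ with hγ1
  set γ2 := deriv γ1 with hγ2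
  set γ3 := deriv γ2 with hγ3
  have i11 : ∀ y, inner ℝ (γ1 y) (γ1 y) = 1 := by
    intro y; rw [real_inner_self_eq_norm_sq, hspeed]; norm_num
  have i12 : ∀ y, inner ℝ (γ1 y) (γ2 y) = 0 := by
    intro y
    have h1 := (d1 y).inner ℝ (d1 y)
    have h2 : (fun t => inner ℝ (γ1 t) (γ1 t)) = fun _ => (1:ℝ) := funext i11
    rw [h2] at h1
    have h3 := h1.unique (hasDerivAt_const y (1:ℝ))
    rw [real_inner_comm (γ1 y) (γ2 y)] at h3
    linarith
  have i13 : ∀ y, inner ℝ (γ1 y) (γ3 y) = -‖γ2 y‖ ^ 2 := by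
    intro y
    have h1 := (d1 y).inner ℝ (d2 y)
    have h2 : (fun t => inner ℝ (γ1 t) (γ2 t)) = fun _ => (0:ℝ) := funext i12
    rw [h2] at h1
    have h3 := h1.unique (hasDerivAt_const y (0:ℝ))
    rw [real_inner_self_eq_norm_sq] at h3
    linarith
  have tr : ∀ (f f' : ℝ → V), (∀ y, HasDerivAt f (f' y) y) → ∀ t,
      HasDerivAt (fun t => f (x + t)) (f' (x + t)) t := by
    intro f f' hf t
    exact HasDerivAt.comp_const_add x t (hf (x + t))
  have dD : ∀ t, HasDerivAt (fun t => γ (x + t) - γ x) (γ1 (x + t)) t := fun t =>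
    (tr γ γ1 d0 t).sub_const _
  have a4 : Tendsto (fun t => 2 * inner ℝ (γ (x + t) - γ x) (γ3 (x + t)) / t ^ 1)
      (nhdsWithin 0 {0}ᶜ) (nhds (2 * -‖γ2 x‖ ^ 2)) := by
    have h1 := (dD 0).tendsto_slope_zero
    have hc3 : Continuous γ3 := ((contDiff_infty_iff_deriv.1 c2).2).continuous
    have h2 : Tendsto (fun t => γ3 (x + t)) (nhdsWithin 0 {0}ᶜ) (nhds (γ3 x)) := by
      have : Continuous fun t => γ3 (x + t) := by fun_prop
      have := this.tendsto 0
      rw [add_zero] at this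
      exact this.mono_left nhdsWithin_le_nhds
    have h3 := ((h1.inner h2 (𝕜 := ℝ)).const_mul 2)
    rw [add_zero, i13] at h3
    refine h3.congr fun t => ?_
    simp only [zero_add, sub_self, sub_zero, inner_smul_left, pow_one]
    simp
    ring
  have a3 := bry_div (fun t => 2 * inner ℝ (γ (x + t) - γ x) (γ2 (x + t))) _ (fun t => by
    have := ((dD t).inner ℝ (tr γ2 γ3 d2 t)).const_mul 2
    rw [i12, add_zero] at this
    exact this) (by simp) 1 _ a4
  have a2 := bry_div (fun t => 2 * inner ℝ (γ (x + t) - γ x) (γ1 (x + t)) - 2 * t) _ (fun t => by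
    have := (((dD t).inner ℝ (tr γ1 γ2 d1 t)).const_mul 2).sub ((hasDerivAt_id t).const_mul 2)
    rw [i11] at this
    refine this.congr_deriv ?_
    ring) (by simp) 2 _ a3
  have a1 := bry_div (fun t => inner ℝ (γ (x + t) - γ x) (γ (x + t) - γ x) - t ^ 2) _ (fun t => by
    have := ((dD t).inner ℝ (dD t)).sub (hasDerivAt_pow 2 t)
    refine this.congr_deriv ?_
    rw [real_inner_comm (γ (x + t) - γ x) (γ1 (x + t))]
    simp
    ring) (by simp) 3 _ a2
  have e : 2 * -‖γ2 x‖ ^ 2 / (((1 : ℕ) : ℝ) + 1) / (((2 : ℕ) : ℝ) + 1) / (((3 : ℕ) : ℝ) + 1)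
      = -‖γ2 x‖ ^ 2 / 12 := by push_cast; ring
  rw [e] at a1
  refine a1.congr fun t => ?_
  rw [real_inner_self_eq_norm_sq]

theorem bry_abs_integrable_pos (a : ℝ) (ha : 0 < a) (s : ℂ) (hs : -1 < s.re) :
    IntervalIntegrable (fun t : ℝ => ((|t| : ℝ) : ℂ) ^ s) volume 0 a := by
  refine (intervalIntegral.intervalIntegrable_cpow' (a := 0) (b := a) hs).congr ?_
  intro t ht
  rw [Set.uIoc_of_le ha.le] at ht
  simp only [abs_of_pos ht.1]

theorem bry_abs_integrable_neg (a : ℝ) (ha : 0 < a) (s : ℂ) (hs : -1 < s.re) :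
    IntervalIntegrable (fun t : ℝ => ((|t| : ℝ) : ℂ) ^ s) volume (-a) 0 := by
  have h1 := bry_abs_integrable_pos a ha s hs
  rw [IntervalIntegrable.iff_comp_neg (by simp)] at h1
  simpa using h1.symm

theorem bry_even_int (a : ℝ) (ha : 0 < a) (s : ℂ) (hs : -1 < s.re) (H : ℝ → ℂ)
    (hc : Continuous H) (he : ∀ t, H (-t) = H t) :
    ∫ t in (-a)..a, ((|t| : ℝ) : ℂ) ^ s * H t = 2 * ∫ t in (0:ℝ)..a, (t : ℂ) ^ s * H t := by
  rw [← intervalIntegral.integral_add_adjacent_intervals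
    ((bry_abs_integrable_neg a ha s hs).mul_continuousOn hc.continuousOn)
    ((bry_abs_integrable_pos a ha s hs).mul_continuousOn hc.continuousOn)]
  have h1 : ∫ t in (-a)..0, ((|t| : ℝ) : ℂ) ^ s * H t =
      ∫ t in (0:ℝ)..a, ((|t| : ℝ) : ℂ) ^ s * H t := by
    have := intervalIntegral.integral_comp_neg (a := 0) (b := a)
      (fun t => ((|t| : ℝ) : ℂ) ^ s * H t)
    simp only [abs_neg, he, neg_zero] at this
    exact this.symm
  have h2 : ∫ t in (0:ℝ)..a, ((|t| : ℝ) : ℂ) ^ s * H t =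
      ∫ t in (0:ℝ)..a, (t : ℂ) ^ s * H t := by
    refine intervalIntegral.integral_congr fun t ht => ?_
    rw [Set.uIcc_of_le ha.le] at ht
    simp only [abs_of_nonneg ht.1]
  rw [h1, h2]; ring

theorem bry_fubini (L a : ℝ) (hL : 0 < L) (ha : 0 < a) (s : ℂ) (hs : -1 < s.re) (φ : ℝ × ℝ → ℂ)
    (hc : Continuous φ) :
    ∫ x in Set.Ioc (0:ℝ) L, (∫ t in (-a)..a, ((|t| : ℝ) : ℂ) ^ s * φ (x, t)) =
      ∫ t in (-a)..a, ((|t| : ℝ) : ℂ) ^ s * ∫ x in (0:ℝ)..L, φ (x, t) := by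
  have haa : -a ≤ a := by linarith
  simp only [intervalIntegral.integral_of_le haa, intervalIntegral.integral_of_le hL.le]
  rw [integral_integral_swap]
  · refine integral_congr_ae (Eventually.of_forall fun t => ?_)
    exact integral_const_mul _ _
  · have h1 : Integrable (fun t : ℝ => ((|t| : ℝ) : ℂ) ^ s) (volume.restrict (Set.Ioc (-a) a)) :=
      (intervalIntegrable_iff_integrableOn_Ioc_of_le haa).1
        ((bry_abs_integrable_neg a ha s hs).trans (bry_abs_integrable_pos a ha s hs))
    have h2 := h1.comp_snd (volume.restrict (Set.Ioc (0:ℝ) L))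
    obtain ⟨C, hC⟩ := ((isCompact_Icc (a := (0:ℝ)) (b := L)).prod
      (isCompact_Icc (a := -a) (b := a))).exists_bound_of_continuousOn hc.continuousOn
    refine h2.mul_bdd (c := C) hc.aestronglyMeasurable ?_
    rw [Measure.prod_restrict]
    filter_upwards [ae_restrict_mem (measurableSet_Ioc.prod measurableSet_Ioc)] with z hz
    exact hC z ⟨Set.Ioc_subset_Icc_self hz.1, Set.Ioc_subset_Icc_self hz.2⟩


theorem bry_ne (L : ℝ) (hL : 0 < L) {V : Type} (γ : ℝ → V)
    (hper : Function.Periodic γ L) (hinj : Set.InjOn γ (Set.Ico 0 L)) (x t : ℝ) (ht : t ≠ 0)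
    (htL : |t| < L) : γ (x + t) ≠ γ x := by
  intro h
  have hm : ∀ y, γ (toIcoMod hL 0 y) = γ y := by
    intro y
    rw [← self_sub_toIcoDiv_zsmul]
    exact hper.sub_zsmul_eq _
  have h1 : toIcoMod hL 0 x = toIcoMod hL 0 (x + t) := by
    refine hinj ?_ ?_ ?_
    · simpa using toIcoMod_mem_Ico hL 0 x
    · simpa using toIcoMod_mem_Ico hL 0 (x + t)
    · rw [hm, hm, h]
  obtain ⟨n, hn⟩ := (toIcoMod_eq_toIcoMod hL).1 h1
  have hn' : t = n * L := by
    rw [zsmul_eq_mul] at hn; linarith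
  have hn0 : n ≠ 0 := by
    rintro rfl
    apply ht; simpa using hn'
  have : (1 : ℝ) ≤ |(n : ℝ)| := by exact_mod_cast Int.one_le_abs hn0
  rw [hn', abs_mul, abs_of_pos hL] at htL
  nlinarith

theorem bry_phi_deriv :
    HasDerivAt (fun y : ℝ => Complex.exp (-3 / 2 * ((Real.log y : ℝ) : ℂ))) (-3 / 2) 1 := by
  have h1 : HasDerivAt (fun y : ℝ => ((Real.log y : ℝ) : ℂ)) ((1⁻¹ : ℝ) : ℂ) 1 :=
    (Real.hasDerivAt_log one_ne_zero).ofReal_comp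
  have h2 := (h1.const_mul (-3 / 2 : ℂ)).cexp
  simpa using h2

set_option maxHeartbeats 400000 in
theorem brylinski_beta_residue_neg_three
    (L : ℝ) (hL : 0 < L) (γ : ℝ → EuclideanSpace ℝ (Fin 3))
    (hγ : ContDiff ℝ (⊤ : ℕ∞) γ) (hper : Function.Periodic γ L)
    (hspeed : ∀ x, ‖deriv γ x‖ = 1) (hinj : Set.InjOn γ (Set.Ico 0 L)) :
    ∃ F : ℂ → ℂ,
      (∀ s : ℂ, -1 < s.re →
        F s = ∫ x in Set.Ioc (0 : ℝ) L, ∫ y in Set.Ioc (0 : ℝ) L,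
          (‖γ x - γ y‖ : ℂ) ^ s) ∧
      (∀ s : ℂ, (∀ j : ℕ, s ≠ -1 - 2 * j) → AnalyticAt ℂ F s) ∧
      (∃ G : ℂ → ℂ, AnalyticAt ℂ G (-3) ∧
        ∀ᶠ s in nhdsWithin (-3 : ℂ) {(-3 : ℂ)}ᶜ,
          F s = ((1 / 4 * ∫ x in Set.Ioc (0 : ℝ) L, ‖deriv (deriv γ) x‖ ^ 2 : ℝ) : ℂ)
              / (s + 3) + G s) := by
  obtain ⟨q, hq, hqe⟩ := bry_hadamard (fun z : ℝ × ℝ => γ (z.1 + z.2)) (hγ.comp (by fun_prop))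
  simp only [add_zero] at hqe
  have hqc := hq.continuous
  -- norm relation
  have hqn : ∀ x t, ‖γ (x + t) - γ x‖ = |t| * ‖q (x, t)‖ := by
    intro x t
    rw [hqe x t, add_sub_cancel_left, norm_smul, Real.norm_eq_abs]
  have hq0 : ∀ x, q (x, 0) = deriv γ x := by
    intro x
    have h1 := ((hγ.differentiable (by simp) x).hasDerivAt).tendsto_slope_zero
    have h2 : Tendsto (fun t => q (x, t)) (nhdsWithin 0 {0}ᶜ) (nhds (q (x, 0))) := by
      have : Continuous fun t => q (x, t) := by fun_prop
      exact (this.tendsto 0).mono_left nhdsWithin_le_nhds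
    refine tendsto_nhds_unique_of_eventuallyEq h2 h1 ?_
    filter_upwards [self_mem_nhdsWithin] with t ht
    rw [hqe x t, add_sub_cancel_left, smul_smul, inv_mul_cancel₀ ht, one_smul]
  have hq0n : ∀ x, ‖q (x, 0)‖ = 1 := fun x => by rw [hq0, hspeed]
  set a : ℝ := L / 2 with ha_def
  have ha : 0 < a := by rw [ha_def]; linarith
  have hqpos : ∀ x t, |t| ≤ a → 0 < ‖q (x, t)‖ := by
    intro x t ht
    by_cases h0 : t = 0
    · rw [h0, hq0n]; exact one_pos
    · have h1 := bry_ne L hL γ hper hinj x t h0 (by rw [ha_def] at ht; linarith)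
      have h2 : 0 < ‖γ (x + t) - γ x‖ := norm_pos_iff.2 (sub_ne_zero.2 h1)
      rw [hqn] at h2
      exact pos_of_mul_pos_right h2 (abs_nonneg t)
  let ψ : ℝ → ℝ := fun t => expNegInvGlue (t ^ 2 - a ^ 2)
  have hψ0 : ∀ t, |t| ≤ a → ψ t = 0 := fun t ht =>
    expNegInvGlue.zero_of_nonpos (by
      have := sq_le_sq' (by linarith [abs_nonneg t]) ht
      rw [sq_abs] at this; linarith)
  let g : ℝ → ℝ → ℝ := fun x t => ‖q (x, t)‖ ^ 2 + ψ t
  have hg_small : ∀ x t, |t| ≤ a → g x t = ‖q (x, t)‖ ^ 2 := fun x t ht => by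
    simp only [g, hψ0 t ht, add_zero]
  have hgpos : ∀ x t, 0 < g x t := by
    intro x t
    rcases le_or_gt |t| a with h | h
    · rw [hg_small x t h]
      have := hqpos x t h
      positivity
    · have : 0 < ψ t := expNegInvGlue.pos_of_pos (by
        have : a ^ 2 < |t| ^ 2 := by gcongr
        rw [sq_abs] at this; linarith)
      simp only [g]; positivity
  have hg0 : ∀ x, g x 0 = 1 := by
    intro x
    rw [hg_small x 0 (by simpa using ha.le), hq0n]; norm_num
  have hgsm : ContDiff ℝ (⊤ : ℕ∞) (fun z : ℝ × ℝ => g z.1 z.2) := by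
    have h1 : ContDiff ℝ (⊤ : ℕ∞) (fun z : ℝ × ℝ => ‖q z‖ ^ 2) := hq.norm_sq ℝ
    have h2 : ContDiff ℝ (⊤ : ℕ∞) (fun z : ℝ × ℝ => ψ z.2) :=
      expNegInvGlue.contDiff.comp (by fun_prop)
    exact h1.add h2
  have hqn_ne : ∀ x y t t', t ≠ 0 → |t| = |t'| → ‖γ (x + t) - γ x‖ = ‖γ (y + t') - γ y‖ →
      ‖q (x, t)‖ = ‖q (y, t')‖ := by
    intro x y t t' ht htt h
    rw [hqn, hqn, ← htt] at h
    exact mul_left_cancel₀ (abs_ne_zero.2 ht) h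
  have hgper : ∀ x t, g (x + L) t = g x t := by
    intro x t
    by_cases h0 : t = 0
    · rw [h0, hg0, hg0]
    · simp only [g]
      rw [hqn_ne (x + L) x t t h0 rfl]
      rw [add_right_comm, hper, hper]
  have hgeven : ∀ x t, g x (-t) = g (x - t) t := by
    intro x t
    by_cases h0 : t = 0
    · rw [h0, neg_zero, hg0, hg0]
    · simp only [g, ψ, neg_sq]
      rw [hqn_ne x (x - t) (-t) t (neg_ne_zero.2 h0) (abs_neg t)]
      rw [sub_add_cancel, ← sub_eq_add_neg, norm_sub_rev]
  let f : (ℂ × ℝ) × ℝ → ℂ := fun z =>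
    Complex.exp (z.1.1 / 2 * ((Real.log (g z.2 z.1.2) : ℝ) : ℂ))
  have hlog : ContDiff ℝ (⊤ : ℕ∞) (fun z : ℝ × ℝ => Real.log (g z.1 z.2)) :=
    hgsm.log fun z => (hgpos z.1 z.2).ne'
  have hlogC : ContDiff ℝ (⊤ : ℕ∞) (fun z : ℝ × ℝ => ((Real.log (g z.1 z.2) : ℝ) : ℂ)) :=
    Complex.ofRealCLM.contDiff.comp hlog
  have hf : ContDiff ℝ (⊤ : ℕ∞) f := by
    refine ContDiff.cexp ?_
    refine ContDiff.mul (by fun_prop) ?_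
    exact hlogC.comp (f := fun z : (ℂ × ℝ) × ℝ => (z.2, z.1.2)) (by fun_prop)
  have hfc := hf.continuous
  let h : ℂ × ℝ → ℂ := fun p => ∫ x in (0:ℝ)..L, f (p, x)
  have hh : BryClass h := by
    refine ⟨bry_contDiff_param 0 L f hf, ?_, ?_⟩
    · intro t s₀
      simp only [h, intervalIntegral.integral_of_le hL.le]
      have hc2 : Continuous fun z : ℂ × ℝ => f ((z.1, t), z.2) := by fun_prop
      obtain ⟨C, hC⟩ := ((isCompact_closedBall s₀ (2 * 1)).prod
        (isCompact_Icc (a := (0:ℝ)) (b := L))).exists_bound_of_continuousOn hc2.continuousOn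
      refine bry_holo_integral _ (fun s x => f ((s, t), x)) s₀ 1 one_pos (fun _ => C) ?_ ?_ ?_
        (integrable_const C)
      · intro s
        have : Continuous fun x => f ((s, t), x) := by fun_prop
        exact this.aestronglyMeasurable
      · refine Eventually.of_forall fun x => ?_
        simp only [f]
        fun_prop
      · filter_upwards [ae_restrict_mem measurableSet_Ioc] with x hx s hs
        exact hC (s, x) ⟨hs, Set.Ioc_subset_Icc_self hx⟩
    · intro s t
      have h1 : h (s, -t) = ∫ x in (0:ℝ)..L, f ((s, t), x - t) := by
        simp only [h, f, hgeven]
      rw [h1, intervalIntegral.integral_comp_sub_right (fun x => f ((s, t), x)) t]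
      have hp : Function.Periodic (fun x => f ((s, t), x)) L := by
        intro x
        simp only [f, hgper]
      have := hp.intervalIntegral_add_eq (0 - t) 0
      rw [zero_add] at this
      refine Eq.trans ?_ this
      congr 1
      ring
  obtain ⟨F, hF1, hF2, k, hk, hke, G, hG, hFG⟩ := bry_continuation hh a ha
  -- residue
  have hres : k (-3, 0) = ((1 / 8 * ∫ x in Set.Ioc (0 : ℝ) L, ‖deriv (deriv γ) x‖ ^ 2 : ℝ) : ℂ) := by
    let φ : ℝ × ℝ → ℂ := fun z => f ((-3, z.2), z.1)
    have hφ : ContDiff ℝ (⊤ : ℕ∞) φ := hf.comp (by fun_prop)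
    have hφ0 : ∀ x, φ (x, 0) = 1 := by
      intro x; simp only [φ, f, hg0]; simp
    obtain ⟨φ₁, hφ₁, e₁⟩ := bry_hadamard φ hφ
    obtain ⟨φ₂, hφ₂, e₂⟩ := bry_hadamard φ₁ hφ₁
    have hc1 := hφ₁.continuous
    have hc2 := hφ₂.continuous
    have hlimg : ∀ x, Tendsto (fun t => (g x t - 1) / t ^ 2) (nhdsWithin 0 {0}ᶜ)
        (nhds (-‖deriv (deriv γ) x‖ ^ 2 / 12)) := by
      intro x
      refine (bry_local γ hγ hspeed x).congr' ?_
      have hsm : ∀ᶠ t in nhdsWithin (0:ℝ) {0}ᶜ, |t| ≤ a := by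
        refine nhdsWithin_le_nhds ?_
        filter_upwards [Metric.ball_mem_nhds (0:ℝ) ha] with t ht
        rw [Metric.mem_ball, Real.dist_eq, sub_zero] at ht
        exact ht.le
      filter_upwards [hsm, self_mem_nhdsWithin] with t ht ht0
      have ht0' : t ≠ 0 := ht0
      rw [hg_small x t ht, hqn, mul_pow, sq_abs]
      field_simp
    have hgt : ∀ x, Tendsto (fun t => g x t) (nhdsWithin 0 {0}ᶜ) (nhds 1) := by
      intro x
      have h1 : Continuous fun t => g x t :=
        Continuous.comp (g := fun z : ℝ × ℝ => g z.1 z.2) (f := fun t : ℝ => (x, t))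
          hgsm.continuous (by fun_prop)
      have h2 := h1.tendsto 0
      rw [hg0] at h2
      exact h2.mono_left nhdsWithin_le_nhds
    set Φ : ℝ → ℂ := fun y : ℝ => Complex.exp (-3 / 2 * ((Real.log y : ℝ) : ℂ)) with hΦ
    have hlim : ∀ x, Tendsto (fun t : ℝ => (φ (x, t) - 1) / (t : ℂ) ^ 2) (nhdsWithin 0 {0}ᶜ)
        (nhds ((1 / 8 * ‖deriv (deriv γ) x‖ ^ 2 : ℝ) : ℂ)) := by
      intro x
      have h1 : Tendsto (fun t => dslope Φ 1 (g x t)) (nhdsWithin 0 {0}ᶜ) (nhds (-3 / 2)) := by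
        have h2 : ContinuousAt (dslope Φ 1) 1 :=
          continuousAt_dslope_same.2 bry_phi_deriv.differentiableAt
        have h3 := h2.tendsto
        rw [dslope_same, bry_phi_deriv.deriv] at h3
        exact h3.comp (hgt x)
      have h4 := (hlimg x).smul h1
      have e : (-‖deriv (deriv γ) x‖ ^ 2 / 12) • (-3 / 2 : ℂ) =
          ((1 / 8 * ‖deriv (deriv γ) x‖ ^ 2 : ℝ) : ℂ) := by
        rw [Complex.real_smul]; push_cast; ring
      rw [e] at h4
      refine h4.congr fun t => ?_
      have h5 := sub_smul_dslope Φ 1 (g x t)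
      have h6 : Φ 1 = 1 := by simp [hΦ]
      have h7 : Φ (g x t) = φ (x, t) := rfl
      rw [h6, h7] at h5
      rw [← h5, Complex.real_smul, Complex.real_smul]
      push_cast; ring
    have htz : Tendsto (fun t : ℝ => (t : ℂ)) (nhdsWithin 0 {0}ᶜ) (nhds 0) := by
      have := (Complex.continuous_ofReal.tendsto 0)
      rw [Complex.ofReal_zero] at this
      exact this.mono_left nhdsWithin_le_nhds
    have hφ₁0 : ∀ x, φ₁ (x, 0) = 0 := by
      intro x
      have h1 := htz.mul (hlim x)
      rw [zero_mul] at h1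
      have h2 : Tendsto (fun t => φ₁ (x, t)) (nhdsWithin 0 {0}ᶜ) (nhds (φ₁ (x, 0))) := by
        have : Continuous fun t => φ₁ (x, t) := by fun_prop
        exact (this.tendsto 0).mono_left nhdsWithin_le_nhds
      refine tendsto_nhds_unique_of_eventuallyEq h2 h1 ?_
      filter_upwards [self_mem_nhdsWithin] with t ht
      have ht' : (t : ℂ) ≠ 0 := by exact_mod_cast ht
      rw [e₁ x t, hφ0, Complex.real_smul]
      field_simp
      ring
    have eφ : ∀ x t, φ (x, t) = 1 + (t : ℂ) ^ 2 * φ₂ (x, t) := by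
      intro x t
      rw [e₁ x t, e₂ x t, hφ0, hφ₁0, Complex.real_smul, Complex.real_smul]
      ring
    have hφ₂0 : ∀ x, φ₂ (x, 0) = ((1 / 8 * ‖deriv (deriv γ) x‖ ^ 2 : ℝ) : ℂ) := by
      intro x
      have h2 : Tendsto (fun t => φ₂ (x, t)) (nhdsWithin 0 {0}ᶜ) (nhds (φ₂ (x, 0))) := by
        have : Continuous fun t => φ₂ (x, t) := by fun_prop
        exact (this.tendsto 0).mono_left nhdsWithin_le_nhds
      refine tendsto_nhds_unique_of_eventuallyEq h2 (hlim x) ?_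
      filter_upwards [self_mem_nhdsWithin] with t ht
      have ht' : (t : ℂ) ≠ 0 := by exact_mod_cast ht
      rw [eφ x t]
      field_simp
      ring
    have hkφ : (fun t => k (-3, t)) = fun t => ∫ x in (0:ℝ)..L, φ₂ (x, t) := by
      have hkc := hk.smooth.continuous
      refine Continuous.ext_on (s := {(0:ℝ)}ᶜ) (dense_compl_singleton 0) (by fun_prop) ?_ ?_
      · exact intervalIntegral.continuous_parametric_intervalIntegral_of_continuous'
          (f := fun t x => φ₂ (x, t)) (by simp only [Function.uncurry_def]; fun_prop) 0 L
      · intro t ht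
        have ht' : (t : ℂ) ≠ 0 := by exact_mod_cast ht
        have h1 := hke (-3) t
        have h2 : ∀ t : ℝ, h (-3, t) = L + (t : ℂ) ^ 2 * ∫ x in (0:ℝ)..L, φ₂ (x, t) := by
          intro t
          have h3 : h (-3, t) = ∫ x in (0:ℝ)..L, (1 + (t : ℂ) ^ 2 * φ₂ (x, t)) :=
            intervalIntegral.integral_congr fun x _ => eφ x t
          have h4 : Continuous fun x => (t : ℂ) ^ 2 * φ₂ (x, t) := by fun_prop
          rw [h3, intervalIntegral.integral_add (by simp) (h4.intervalIntegrable _ _),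
            intervalIntegral.integral_const_mul]
          simp
        rw [h2 t, h2 0] at h1
        refine mul_left_cancel₀ (pow_ne_zero 2 ht') ?_
        simp only
        simp at h1
        rcases h1 with h1 | h1
        · rw [h1]
        · exact absurd h1 ht
    have := congrFun hkφ 0
    simp only [hφ₂0] at this
    rw [this, intervalIntegral.integral_ofReal, intervalIntegral.integral_const_mul,
      intervalIntegral.integral_of_le hL.le]
  refine ⟨fun s => 2 * F s, ?_, ?_, fun s => 2 * G s, analyticAt_const.mul hG, ?_⟩
  · intro s hs
    have hin : ∀ x, ∫ y in Set.Ioc (0 : ℝ) L, (‖γ x - γ y‖ : ℂ) ^ s =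
        ∫ t in (-a)..a, ((|t| : ℝ) : ℂ) ^ s * f ((s, t), x) := by
      intro x
      have hp : Function.Periodic (fun y => (‖γ x - γ y‖ : ℂ) ^ s) L := by
        intro y
        simp only [hper y]
      have h1 := hp.intervalIntegral_add_eq 0 (x + -a)
      rw [zero_add] at h1
      have h2 := intervalIntegral.integral_comp_add_left (a := -a) (b := a)
        (fun y => (‖γ x - γ y‖ : ℂ) ^ s) x
      have e : x + -a + L = x + a := by rw [ha_def]; ring
      rw [← intervalIntegral.integral_of_le hL.le, h1, e, ← h2]
      refine intervalIntegral.integral_congr fun t ht => ?_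
      rw [Set.uIcc_of_le (by linarith)] at ht
      have hta : |t| ≤ a := abs_le.2 ht
      have hp := hqpos x t hta
      have hpc : ((‖q (x, t)‖ : ℝ) : ℂ) ≠ 0 := by exact_mod_cast hp.ne'
      simp only [f]
      rw [norm_sub_rev, hqn, hg_small x t hta, Complex.ofReal_mul,
        Complex.mul_cpow_ofReal_nonneg (abs_nonneg t) hp.le]
      congr 1
      rw [Complex.cpow_def_of_ne_zero hpc, ← Complex.ofReal_log hp.le, Real.log_pow]
      congr 1
      push_cast
      ring
    simp only [hin]
    rw [bry_fubini L a hL ha s hs (fun z => f ((s, z.2), z.1)) (by fun_prop), hF1 s hs]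
    have hhc := hh.smooth.continuous
    exact (bry_even_int a ha s hs (fun t => h (s, t)) (by fun_prop) (hh.even s)).symm
  · intro s hs
    exact analyticAt_const.mul (hF2 s hs)
  · filter_upwards [hFG] with s hs
    rw [hs, hres]
    push_cast
    ring
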